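/- |Fh_{fun_2}(16) ∩ S_16| = 47 and |Fh_{fun_4}(16) ∩ S_16| = 43. -/

import Mathlib

open scoped BigOperators

/-- Boolean functions in `n` variables. -/
abbrev BF (n : ℕ) := (Fin n → ZMod 2) → ZMod 2

/-- Hamming distance between two Boolean functions. -/
def hd {n : ℕ} (f g : BF n) : ℕ :=
  (Finset.univ.filter (fun x : Fin n → ZMod 2 => f x ≠ g x)).card

/-- The Reed--Muller code `RM(r,n)`: Boolean functions given by evaluation of a
multivariate polynomial over `F_2` of total degree at most `r`. -/
def RM (r n : ℕ) : Set (BF n) :=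
  {f | ∃ p : MvPolynomial (Fin n) (ZMod 2),
    p.totalDegree ≤ r ∧ ∀ x, f x = MvPolynomial.eval x p}

/-- The `r`-th order nonlinearity of a Boolean function. -/
noncomputable def nl (r : ℕ) {n : ℕ} (f : BF n) : ℕ :=
  sInf {d | ∃ g ∈ RM r n, d = hd f g}

/-- Concatenation `f1 || f2` of two Boolean functions. -/
def concat {n : ℕ} (f1 f2 : BF n) : BF (n + 1) :=
  fun x => (1 + x (Fin.last n)) * f1 (x ∘ Fin.castSucc)
    + x (Fin.last n) * f2 (x ∘ Fin.castSucc)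

/-- A Boolean function is homogeneous quadratic if it is of the form
`∑_{i<j} a_{ij} x_i x_j`. -/
def HomQuad {n : ℕ} (g : BF n) : Prop :=
  ∃ a : Fin n → Fin n → ZMod 2,
    ∀ x, g x = ∑ i : Fin n, ∑ j : Fin n, (if i < j then a i j * x i * x j else 0)

/-- `Fh f r` is the set of homogeneous quadratic functions `g` with `nl(f+g) = r`. -/
def Fh {n : ℕ} (f : BF n) (r : ℕ) : Set (BF n) :=
  {g | HomQuad g ∧ nl 1 (f + g) = r}

/-- `NFh f r = |Fh f r|`. -/
noncomputable def NFh {n : ℕ} (f : BF n) (r : ℕ) : ℕ := (Fh f r).ncard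

/-- The set of 6-variable Boolean functions with nonlinearity 16. -/
def S16 : Set (BF 6) := {f | nl 1 f = 16}

/-- `f1` and `f2` are affine equivalent modulo `RM(r,n)`. -/
def AffEquivMod (r n : ℕ) (f1 f2 : BF n) : Prop :=
  ∃ A : Matrix (Fin n) (Fin n) (ZMod 2), IsUnit A ∧ ∃ b : Fin n → ZMod 2,
    (fun x => f1 x + f2 (A.mulVec x + b)) ∈ RM r n

def fun1 : BF 6 := fun x => x 0*x 1*x 5 + x 0*x 2*x 4 + x 1*x 2*x 3

def fun2 : BF 6 := fun x => x 0*x 1*x 2*x 3 + x 0*x 1*x 5 + x 0*x 3*x 4 + x 1*x 2*x 4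

def fun3 : BF 6 := fun x => x 0*x 1*x 2*x 3 + x 0*x 2*x 4 + x 0*x 3*x 5 + x 1*x 2*x 4
  + x 1*x 2*x 5 + x 1*x 3*x 4

def fun4 : BF 6 := fun x => x 0*x 1*x 2*x 5 + x 0*x 1*x 3*x 4 + x 0*x 2*x 4
  + x 0*x 3*x 4 + x 0*x 3*x 5 + x 1*x 2*x 3

def fun5 : BF 6 := fun x => x 0*x 1*x 2*x 3*x 4 + x 0*x 2*x 4 + x 0*x 3*x 5
  + x 1*x 2*x 4 + x 1*x 2*x 5 + x 1*x 3*x 4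

def fun6 : BF 6 := fun x => x 0*x 1*x 2*x 3*x 4*x 5 + x 0*x 1*x 5 + x 0*x 2*x 4
  + x 1*x 2*x 3

def fun7 : BF 6 := fun x => x 0*x 1*x 2*x 3*x 4*x 5 + x 0*x 1*x 2*x 3 + x 0*x 1*x 5
  + x 0*x 3*x 4 + x 1*x 2*x 4 + x 3*x 4

def fun8 : BF 6 := fun x => x 0*x 1*x 2*x 3*x 4*x 5 + x 0*x 1*x 2*x 3 + x 0*x 2*x 4
  + x 0*x 3*x 5 + x 1*x 2*x 4 + x 1*x 2*x 5 + x 1*x 3*x 4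

def fun9 : BF 6 := fun x => x 0*x 1*x 2*x 3*x 4*x 5 + x 0*x 1*x 2*x 5 + x 0*x 1*x 3*x 4
  + x 0*x 2*x 4 + x 0*x 3*x 4 + x 0*x 3*x 5 + x 1*x 2*x 3 + x 3*x 5

def fun10 : BF 6 := fun x => x 0*x 1*x 2*x 3*x 4*x 5 + x 0*x 1*x 2*x 3 + x 0*x 2*x 3
  + x 0*x 4*x 5 + x 1*x 2*x 3 + x 1*x 2*x 5 + x 1*x 3*x 4 + x 2*x 3 + x 2*x 5 + x 3*x 4

def fun11 : BF 6 := fun x => x 0*x 1*x 2*x 3*x 4*x 5 + x 0*x 1*x 2*x 5 + x 0*x 1*x 3*x 4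
  + x 0*x 2*x 4 + x 0*x 3*x 4 + x 0*x 3*x 5 + x 1*x 2*x 3 + x 1*x 2*x 5 + x 1*x 3*x 4
  + x 2*x 4 + x 3*x 4 + x 3*x 5

def fun12 : BF 6 := fun x => x 0*x 1*x 2*x 3*x 4*x 5 + x 1*x 2*x 3*x 4 + x 0*x 1*x 4*x 5
  + x 0*x 2*x 3*x 5 + x 0*x 1*x 3 + x 0*x 1*x 4 + x 1*x 2*x 4 + x 2*x 3*x 4
  + x 0*x 1*x 5 + x 2*x 3*x 5

def g0 : BF 6 := fun x => x 0*x 1*x 2 + x 0*x 3*x 4 + x 1*x 3*x 5 + x 2*x 4*x 5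
  + x 3*x 4*x 5


/-- The number of points at which `f` differs from the linear form with coefficients `a`. -/
def linDist {n : ℕ} (f : BF n) (a : Fin n → ZMod 2) : ℕ := hd f fun x => a ⬝ᵥ x

section Nonlinearity

variable {n : ℕ}

theorem mem_RM_one_iff (f : BF n) :
    f ∈ RM 1 n ↔ ∃ (c : ZMod 2) (a : Fin n → ZMod 2), ∀ x, f x = c + a ⬝ᵥ x := by
  constructor
  · rintro ⟨p, hp, hf⟩
    refine ⟨p.coeff 0, fun i => p.coeff (Finsupp.single i 1), fun x => ?_⟩
    have hsub : p.support ⊆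
        insert 0 (Finset.univ.image fun i : Fin n => Finsupp.single i 1) := by
      intro m hm
      have hdeg : m.degree ≤ 1 := (MvPolynomial.le_totalDegree hm).trans hp
      rcases Nat.le_one_iff_eq_zero_or_eq_one.1 hdeg with h | h
      · simp [(Finsupp.degree_eq_zero_iff m).1 h]
      · obtain ⟨i, hi⟩ := (Finsupp.sum_eq_one_iff m).1 h
        simp [hi]
    rw [hf, MvPolynomial.eval_eq, Finset.sum_subset hsub]
    · rw [Finset.sum_insert (by simp), Finset.sum_image]
      · simp only [dotProduct]
        congr 1
        · simp
        · refine Finset.sum_congr rfl fun i _ => ?_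
          rw [Finset.prod_eq_single i] <;> simp +contextual [eq_comm]
      · intro i _ j _ h
        exact Finsupp.single_left_injective one_ne_zero h
    · intro m _ hm
      simp [MvPolynomial.notMem_support_iff.1 hm]
  · rintro ⟨c, a, hf⟩
    refine ⟨MvPolynomial.C c + ∑ i, MvPolynomial.C (a i) * MvPolynomial.X i, ?_, fun x => ?_⟩
    · refine (MvPolynomial.totalDegree_add _ _).trans (max_le (by simp) ?_)
      refine MvPolynomial.totalDegree_finsetSum_le fun i _ => ?_
      refine (MvPolynomial.totalDegree_mul _ _).trans ?_
      simp
    · simp [hf, dotProduct]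

theorem zmod_two_cases (c : ZMod 2) : c = 0 ∨ c = 1 := by
  revert c; decide

theorem hd_one_add (f g : BF n) : hd f (fun x => 1 + g x) = 2 ^ n - hd f g := by
  have hflip : ∀ b c : ZMod 2, b ≠ 1 + c ↔ ¬ b ≠ c := by decide
  have h := Finset.card_filter_add_card_filter_not (s := Finset.univ) fun x => f x ≠ g x
  have hcard : (Finset.univ : Finset (Fin n → ZMod 2)).card = 2 ^ n := by
    simp [ZMod.card]
  simp only [hd, hflip]
  omega

theorem hd_le (f g : BF n) : hd f g ≤ 2 ^ n :=
  (Finset.card_le_univ _).trans (by simp [ZMod.card])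

theorem nl_one_eq_iff (f : BF n) (r : ℕ) :
    nl 1 f = r ↔ (∀ c a, r ≤ hd f fun x => c + a ⬝ᵥ x) ∧ ∃ c a, (hd f fun x => c + a ⬝ᵥ x) = r := by
  have hset : {d | ∃ g ∈ RM 1 n, d = hd f g} = {d | ∃ c a, (hd f fun x => c + a ⬝ᵥ x) = d} := by
    ext d
    constructor
    · rintro ⟨g, hg, rfl⟩
      obtain ⟨c, a, h⟩ := (mem_RM_one_iff g).1 hg
      exact ⟨c, a, by rw [funext h]⟩
    · rintro ⟨c, a, rfl⟩
      exact ⟨_, (mem_RM_one_iff _).2 ⟨c, a, fun _ => rfl⟩, rfl⟩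
  rw [nl, hset]
  constructor
  · rintro rfl
    exact ⟨fun c a => Nat.sInf_le ⟨c, a, rfl⟩,
      Nat.sInf_mem (s := {d | ∃ c a, (hd f fun x => c + a ⬝ᵥ x) = d}) ⟨_, 0, 0, rfl⟩⟩
  · rintro ⟨hle, hr⟩
    refine le_antisymm (Nat.sInf_le hr) (le_csInf ⟨r, hr⟩ ?_)
    rintro _ ⟨c, a, rfl⟩
    exact hle c a

theorem nl_one_eq_sixteen_iff (f : BF 6) :
    nl 1 f = 16 ↔ (∀ a, 16 ≤ linDist f a ∧ linDist f a ≤ 48) ∧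
      ∃ a, linDist f a = 16 ∨ linDist f a = 48 := by
  have hzero : ∀ a, (hd f fun x => 0 + a ⬝ᵥ x) = linDist f a := by simp [linDist]
  have hone : ∀ a, (hd f fun x => 1 + a ⬝ᵥ x) = 64 - linDist f a := fun a =>
    hd_one_add f fun x => a ⬝ᵥ x
  have hle : ∀ a, linDist f a ≤ 64 := fun a => hd_le f _
  rw [nl_one_eq_iff]
  constructor
  · rintro ⟨h, c, a, hc⟩
    refine ⟨fun a => ?_, a, ?_⟩
    · have h0 := h 0 a
      have h1 := h 1 a
      rw [hzero] at h0
      rw [hone] at h1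
      have := hle a
      omega
    · have := hle a
      rcases zmod_two_cases c with rfl | rfl
      · rw [hzero] at hc; omega
      · rw [hone] at hc; omega
  · rintro ⟨h, a, ha⟩
    refine ⟨fun c a => ?_, ?_⟩
    · have := h a
      rcases zmod_two_cases c with rfl | rfl
      · rw [hzero]; omega
      · rw [hone]; omega
    · rcases ha with ha | ha
      · exact ⟨0, a, by rw [hzero, ha]⟩
      · exact ⟨1, a, by rw [hone, ha]⟩

end Nonlinearity

section Quadratic

variable {n : ℕ}

/-- The homogeneous quadratic part of the product of two linear forms. -/
def wedge (u v : Fin n → ZMod 2) : BF n := fun x => (u ⬝ᵥ x) * (v ⬝ᵥ x) + (u * v) ⬝ᵥ x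

theorem wedge_eq_sum (u v x : Fin n → ZMod 2) :
    wedge u v x =
      ∑ i, ∑ j, if i < j then (u i * v j + u j * v i) * x i * x j else 0 := by
  have hsq : ∀ b : ZMod 2, b * b = b := by decide
  have hdiag : (u * v) ⬝ᵥ x = ∑ i, ∑ j, if i = j then u i * x i * (v j * x j) else 0 := by
    refine Finset.sum_congr rfl fun i _ => ?_
    rw [Finset.sum_ite_eq]
    simp only [Finset.mem_univ, if_true, Pi.mul_apply]
    linear_combination (-(u i * v i)) * hsq (x i)
  have hlower : (∑ i, ∑ j, if j < i then u i * x i * (v j * x j) else 0) =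
      ∑ i, ∑ j, if i < j then u j * x j * (v i * x i) else 0 := Finset.sum_comm
  have hprod : (u ⬝ᵥ x) * (v ⬝ᵥ x) =
      (∑ i, ∑ j, if i < j then u i * x i * (v j * x j) else 0) +
      (∑ i, ∑ j, if i = j then u i * x i * (v j * x j) else 0) +
      ∑ i, ∑ j, if j < i then u i * x i * (v j * x j) else 0 := by
    simp only [dotProduct, Finset.sum_mul_sum, ← Finset.sum_add_distrib]
    refine Finset.sum_congr rfl fun i _ => Finset.sum_congr rfl fun j _ => ?_
    rcases lt_trichotomy i j with h | h | h
    · simp [h, h.ne, h.not_gt]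
    · simp [h]
    · simp [h, h.ne', h.not_gt]
  rw [wedge, hprod, hdiag, hlower, add_right_comm _ (∑ i, ∑ j, if i = j then _ else _), add_assoc,
    CharTwo.add_self_eq_zero, add_zero, ← Finset.sum_add_distrib]
  refine Finset.sum_congr rfl fun i _ => ?_
  rw [← Finset.sum_add_distrib]
  refine Finset.sum_congr rfl fun j _ => ?_
  split_ifs
  · ring
  · simp

theorem homQuad_wedge (u v : Fin n → ZMod 2) : HomQuad (wedge u v) :=
  ⟨fun i j => u i * v j + u j * v i, wedge_eq_sum u v⟩

theorem wedge_comm (u v : Fin n → ZMod 2) : wedge u v = wedge v u := by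
  funext x
  simp only [wedge, mul_comm]

theorem wedge_self (u : Fin n → ZMod 2) : wedge u u = 0 := by
  have hsq : ∀ b : ZMod 2, b * b = b := by decide
  have hu : u * u = u := funext fun i => hsq (u i)
  funext x
  simp [wedge, hu, hsq, CharTwo.add_self_eq_zero]

theorem wedge_add_right (u v w : Fin n → ZMod 2) :
    wedge u (v + w) = wedge u v + wedge u w := by
  funext x
  simp only [wedge, Pi.add_apply, mul_add, add_dotProduct]
  ring

theorem wedge_zero_left (v : Fin n → ZMod 2) : wedge 0 v = 0 := by
  funext x
  simp [wedge]

/-- The alternating bilinear form with upper triangular coefficients `a`. -/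
def polarForm (a : Fin n → Fin n → ZMod 2) (x y : Fin n → ZMod 2) : ZMod 2 :=
  ∑ i, ∑ j, if i < j then a i j * (x i * y j + x j * y i) else 0

theorem polarForm_add_left (a : Fin n → Fin n → ZMod 2) (x y z : Fin n → ZMod 2) :
    polarForm a (x + y) z = polarForm a x z + polarForm a y z := by
  simp only [polarForm, ← Finset.sum_add_distrib]
  refine Finset.sum_congr rfl fun i _ => Finset.sum_congr rfl fun j _ => ?_
  split_ifs
  · simp only [Pi.add_apply]; ring
  · simp

theorem polarForm_smul_left (a : Fin n → Fin n → ZMod 2) (c : ZMod 2) (x y : Fin n → ZMod 2) :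
    polarForm a (c • x) y = c * polarForm a x y := by
  simp only [polarForm, Finset.mul_sum]
  refine Finset.sum_congr rfl fun i _ => Finset.sum_congr rfl fun j _ => ?_
  split_ifs
  · simp only [Pi.smul_apply, smul_eq_mul]; ring
  · simp

theorem polarForm_comm (a : Fin n → Fin n → ZMod 2) (x y : Fin n → ZMod 2) :
    polarForm a x y = polarForm a y x := by
  simp only [polarForm]
  refine Finset.sum_congr rfl fun i _ => Finset.sum_congr rfl fun j _ => ?_
  split_ifs
  · ring
  · rfl

theorem polarForm_single (a : Fin n → Fin n → ZMod 2) {i j : Fin n} (hij : i < j) :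
    polarForm a (Pi.single i 1) (Pi.single j 1) = a i j := by
  rw [polarForm, Finset.sum_eq_single i, Finset.sum_eq_single j]
  · simp [hij, hij.ne, hij.ne']
  · intro l _ hl
    simp [hl, hij.ne]
  · simp
  · intro k _ hk
    refine Finset.sum_eq_zero fun l _ => ?_
    split_ifs with hkl
    · have : ¬ (l = i ∧ k = j) := by
        rintro ⟨rfl, rfl⟩
        exact absurd hij hkl.not_gt
      rcases not_and_or.1 this with h | h <;> simp [hk, h]
    · rfl
  · simp

theorem quadratic_add {g : BF n} {a : Fin n → Fin n → ZMod 2}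
    (hg : ∀ x, g x = ∑ i, ∑ j, if i < j then a i j * x i * x j else 0) (x y : Fin n → ZMod 2) :
    g (x + y) = g x + g y + polarForm a x y := by
  simp only [hg, polarForm, ← Finset.sum_add_distrib]
  refine Finset.sum_congr rfl fun i _ => Finset.sum_congr rfl fun j _ => ?_
  split_ifs
  · simp only [Pi.add_apply]; ring
  · simp

/-- A quadratic form in four variables with nonzero Pfaffian has nonlinearity at least six. -/
theorem six_le_card_of_pfaffian (c l₀ l₁ l₂ l₃ b₀₁ b₀₂ b₀₃ b₁₂ b₁₃ b₂₃ : ZMod 2)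
    (h : b₀₁ * b₂₃ + b₀₂ * b₁₃ + b₀₃ * b₁₂ ≠ 0) :
    6 ≤ ∑ y : ZMod 2 × ZMod 2 × ZMod 2 × ZMod 2,
      if c + y.1 * l₀ + y.2.1 * l₁ + y.2.2.1 * l₂ + y.2.2.2 * l₃
        + y.1 * y.2.1 * b₀₁ + y.1 * y.2.2.1 * b₀₂ + y.1 * y.2.2.2 * b₀₃
        + y.2.1 * y.2.2.1 * b₁₂ + y.2.1 * y.2.2.2 * b₁₃ + y.2.2.1 * y.2.2.2 * b₂₃ ≠ 0
      then 1 else 0 := by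
  revert c l₀ l₁ l₂ l₃ b₀₁ b₀₂ b₀₃ b₁₂ b₁₃ b₂₃
  decide +kernel

theorem quadratic_add_affine_add_smul {g : BF n} {a : Fin n → Fin n → ZMod 2}
    (hg : ∀ x, g x = ∑ i, ∑ j, if i < j then a i j * x i * x j else 0)
    (c : ZMod 2) (b x e : Fin n → ZMod 2) (y : ZMod 2) :
    g (x + y • e) + (c + b ⬝ᵥ (x + y • e)) =
      g x + (c + b ⬝ᵥ x) + y * (g e + polarForm a x e + b ⬝ᵥ e) := by
  have hzero : g 0 = 0 := by simp [hg]
  rcases zmod_two_cases y with rfl | rfl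
  · simp
  · rw [one_smul, quadratic_add hg, dotProduct_add]
    ring

/-- If the polar form of a quadratic form has a nonzero Pfaffian, its nonlinearity is large:
average over `x` the restrictions to the translates by `x` of a four-dimensional space. -/
theorem le_hd_of_pfaffian {g : BF n} {a : Fin n → Fin n → ZMod 2}
    (hg : ∀ x, g x = ∑ i, ∑ j, if i < j then a i j * x i * x j else 0)
    {e₀ e₁ e₂ e₃ : Fin n → ZMod 2}
    (h : polarForm a e₀ e₁ * polarForm a e₂ e₃ + polarForm a e₀ e₂ * polarForm a e₁ e₃ +
      polarForm a e₀ e₃ * polarForm a e₁ e₂ ≠ 0) (c : ZMod 2) (b : Fin n → ZMod 2) :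
    6 * 2 ^ n ≤ 16 * hd g fun x => c + b ⬝ᵥ x := by
  set w : (Fin n → ZMod 2) → ℕ := fun x => if g x + (c + b ⬝ᵥ x) ≠ 0 then 1 else 0 with hw
  have hwt : (hd g fun x => c + b ⬝ᵥ x) = ∑ x, w x := by
    have hne : ∀ p q : ZMod 2, p ≠ q ↔ p + q ≠ 0 := by decide
    rw [hd, Finset.card_filter]
    exact Finset.sum_congr rfl fun x _ => if_congr (hne _ _) rfl rfl
  calc 6 * 2 ^ n = ∑ _x : Fin n → ZMod 2, 6 := by simp [ZMod.card, mul_comm]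
    _ ≤ ∑ x, ∑ y : ZMod 2 × ZMod 2 × ZMod 2 × ZMod 2,
        w (x + y.1 • e₀ + y.2.1 • e₁ + y.2.2.1 • e₂ + y.2.2.2 • e₃) := by
      refine Finset.sum_le_sum fun x _ => ?_
      have key := six_le_card_of_pfaffian (g x + (c + b ⬝ᵥ x))
        (g e₀ + polarForm a x e₀ + b ⬝ᵥ e₀) (g e₁ + polarForm a x e₁ + b ⬝ᵥ e₁)
        (g e₂ + polarForm a x e₂ + b ⬝ᵥ e₂) (g e₃ + polarForm a x e₃ + b ⬝ᵥ e₃)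
        (polarForm a e₀ e₁) (polarForm a e₀ e₂) (polarForm a e₀ e₃)
        (polarForm a e₁ e₂) (polarForm a e₁ e₃) (polarForm a e₂ e₃) h
      refine key.trans_eq (Finset.sum_congr rfl fun y _ => ?_)
      rw [hw]
      refine if_congr (not_congr (Eq.congr_left ?_)) rfl rfl
      simp only [quadratic_add_affine_add_smul hg, polarForm_add_left, polarForm_smul_left]
      ring
    _ = ∑ _y : ZMod 2 × ZMod 2 × ZMod 2 × ZMod 2, ∑ x, w x := by
      rw [Finset.sum_comm]
      refine Finset.sum_congr rfl fun y _ => ?_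
      simp only [add_assoc]
      exact Equiv.sum_comp
        (Equiv.addRight (y.1 • e₀ + (y.2.1 • e₁ + (y.2.2.1 • e₂ + y.2.2.2 • e₃)))) w
    _ = 16 * hd g fun x => c + b ⬝ᵥ x := by
      rw [hwt, Finset.sum_const]
      simp [ZMod.card]

theorem exists_eq_wedge_of_nl_eq_sixteen {g : BF 6} (hquad : HomQuad g) (hnl : nl 1 g = 16) :
    ∃ u v, g = wedge u v := by
  obtain ⟨a, hg⟩ := hquad
  have hpf : ∀ e₀ e₁ e₂ e₃, polarForm a e₀ e₁ * polarForm a e₂ e₃ +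
      polarForm a e₀ e₂ * polarForm a e₁ e₃ + polarForm a e₀ e₃ * polarForm a e₁ e₂ = 0 := by
    intro e₀ e₁ e₂ e₃
    by_contra h
    obtain ⟨c, b, hcb⟩ := ((nl_one_eq_iff g 16).1 hnl).2
    have := le_hd_of_pfaffian hg h c b
    omega
  by_cases hB : ∀ x y, polarForm a x y = 0
  · refine ⟨0, 0, funext fun x => ?_⟩
    rw [wedge_zero_left, hg]
    refine Finset.sum_eq_zero fun i _ => Finset.sum_eq_zero fun j _ => ?_
    split_ifs with hij
    · rw [← polarForm_single a hij, hB, zero_mul, zero_mul]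
    · rfl
  · push Not at hB
    obtain ⟨s, t, hst⟩ := hB
    have hst : polarForm a s t = 1 := (zmod_two_cases _).resolve_left hst
    refine ⟨fun i => polarForm a s (Pi.single i 1), fun i => polarForm a t (Pi.single i 1),
      funext fun x => ?_⟩
    rw [wedge_eq_sum, hg]
    refine Finset.sum_congr rfl fun i _ => Finset.sum_congr rfl fun j _ => ?_
    split_ifs with hij
    · have h := hpf s t (Pi.single i 1) (Pi.single j 1)
      rw [hst, one_mul, polarForm_single a hij, add_assoc, CharTwo.add_eq_zero] at h
      rw [h]
    · rfl

end Quadratic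
section Table

/-- The bit of `t` at position `i`. -/
def bit (t i : ℕ) : ZMod 2 := (t / 2 ^ i % 2 : ℕ)

theorem bit_eq_ite (t i : ℕ) : bit t i = if t.testBit i then 1 else 0 := by
  rw [bit, ← Nat.toNat_testBit]
  cases t.testBit i <;> rfl

theorem bit_xor (s t i : ℕ) : bit (s ^^^ t) i = bit s i + bit t i := by
  simp only [bit_eq_ite, Nat.testBit_xor]
  cases s.testBit i <;> cases t.testBit i <;> decide

theorem bit_and (s t i : ℕ) : bit (s &&& t) i = bit s i * bit t i := by
  simp only [bit_eq_ite, Nat.testBit_and]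
  cases s.testBit i <;> cases t.testBit i <;> decide

theorem bit_mod_mul (k j m i : ℕ) : bit ((k / 2 ^ j % 2) * m) i = bit k j * bit m i := by
  have h : bit k j = ((k / 2 ^ j % 2 : ℕ) : ZMod 2) := rfl
  rw [h]
  rcases Nat.mod_two_eq_zero_or_one (k / 2 ^ j) with h | h <;> simp [h, bit]

/-- The rank of a point in the lexicographic order. -/
def pointIndex : (n : ℕ) → (Fin n → ZMod 2) → ℕ
  | 0, _ => 0
  | n + 1, x => (x 0).val * 2 ^ n + pointIndex n (Fin.tail x)

/-- The point of rank `k`. -/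
def point (k : ℕ) : Fin 6 → ZMod 2 := fun j => bit k (5 - j)

theorem point_pointIndex (x : Fin 6 → ZMod 2) : point (pointIndex 6 x) = x := by
  revert x; decide +kernel

theorem pointIndex_lt (x : Fin 6 → ZMod 2) : pointIndex 6 x < 64 := by
  revert x; decide +kernel

theorem pointIndex_point {k : ℕ} (hk : k < 64) : pointIndex 6 (point k) = k := by
  revert k; decide +kernel

theorem point_xor (k l : ℕ) : point (k ^^^ l) = point k + point l :=
  funext fun _ => bit_xor _ _ _

theorem point_and (k l : ℕ) : point (k &&& l) = point k * point l :=
  funext fun _ => bit_and _ _ _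

/-- The Boolean function with truth table `t`. -/
def ofTable (t : ℕ) : BF 6 := fun x => bit t (pointIndex 6 x)

theorem ofTable_xor (s t : ℕ) : ofTable (s ^^^ t) = ofTable s + ofTable t :=
  funext fun _ => bit_xor _ _ _

theorem ofTable_and (s t : ℕ) : ofTable (s &&& t) = ofTable s * ofTable t :=
  funext fun _ => bit_and _ _ _

theorem ofTable_injOn : Set.InjOn ofTable {t | t < 2 ^ 64} := by
  intro s hs t ht h
  refine Nat.eq_of_testBit_eq fun i => ?_
  by_cases hi : i < 64
  · have := congrFun h (point i)
    simp only [ofTable, pointIndex_point hi, bit_eq_ite] at this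
    revert this
    cases s.testBit i <;> cases t.testBit i <;> simp
  · have hpow : 2 ^ 64 ≤ 2 ^ i := Nat.pow_le_pow_right two_pos (not_lt.1 hi)
    rw [Nat.testBit_lt_two_pow (lt_of_lt_of_le hs hpow),
      Nat.testBit_lt_two_pow (lt_of_lt_of_le ht hpow)]

/-- The truth table of the coordinate function `j`. -/
def coordTable (j : Fin 6) : ℕ :=
  ![18446744069414584320, 18446462603027742720, 18374966859414961920,
    17361641481138401520, 14757395258967641292, 12297829382473034410] j

theorem ofTable_coordTable (j : Fin 6) (x : Fin 6 → ZMod 2) : ofTable (coordTable j) x = x j := by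
  revert j x; decide +kernel

/-- The truth table of the linear form with coefficients `point k`. -/
def linTable (k : ℕ) : ℕ :=
  (List.finRange 6).foldr (fun (j : Fin 6) t => (k / 2 ^ (5 - (j : ℕ)) % 2) * coordTable j ^^^ t) 0

theorem ofTable_linTable (k : ℕ) (x : Fin 6 → ZMod 2) :
    ofTable (linTable k) x = point k ⬝ᵥ x := by
  have hfold : ∀ l : List (Fin 6),
      ofTable (l.foldr (fun (j : Fin 6) t => (k / 2 ^ (5 - (j : ℕ)) % 2) * coordTable j ^^^ t) 0) x =
        (l.map fun j => point k j * x j).sum := by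
    intro l
    induction l with
    | nil => simp [ofTable, bit]
    | cons j l ih =>
      rw [List.foldr_cons, ofTable_xor, Pi.add_apply, ih, List.map_cons, List.sum_cons, ofTable,
        bit_mod_mul, ← ofTable_coordTable j x]
      rfl
  rw [linTable, hfold, dotProduct, Fin.sum_univ_def]

/-- The truth table of `wedge (point k) (point l)`. -/
def wedgeTable (k l : ℕ) : ℕ := (linTable k &&& linTable l) ^^^ linTable (k &&& l)

theorem ofTable_wedgeTable (k l : ℕ) : ofTable (wedgeTable k l) = wedge (point k) (point l) := by
  funext x
  rw [wedgeTable, ofTable_xor, ofTable_and, Pi.add_apply, Pi.mul_apply]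
  simp only [ofTable_linTable, point_and, wedge]

/-- Truth tables of the nonzero quadratic forms `wedge u v`; each plane `{0, u, v, u + v}` is
listed through its basis with `u < v < u + v`. -/
def wedgeTables : List ℕ :=
  (((List.range 64).product (List.range 64)).filter fun p =>
    0 < p.1 && p.1 < p.2 && p.2 < p.1 ^^^ p.2).map fun p => wedgeTable p.1 p.2

theorem exists_mem_wedgeTables {u v : Fin 6 → ZMod 2} (h : wedge u v ≠ 0) :
    ∃ t ∈ wedgeTables, ofTable t = wedge u v := by
  suffices H : ∃ k l, k < 64 ∧ l < 64 ∧ 0 < k ∧ k < l ∧ l < k ^^^ l ∧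
      wedge (point k) (point l) = wedge u v by
    obtain ⟨k, l, hk, hl, h0, hkl, hlm, heq⟩ := H
    refine ⟨wedgeTable k l, ?_, (ofTable_wedgeTable k l).trans heq⟩
    refine List.mem_map.2 ⟨(k, l), List.mem_filter.2 ⟨?_, ?_⟩, rfl⟩
    · simp [hk, hl]
    · simp [h0, hkl, hlm]
  obtain ⟨k, hk, rfl⟩ : ∃ k < 64, point k = u :=
    ⟨_, pointIndex_lt u, point_pointIndex u⟩
  obtain ⟨l, hl, rfl⟩ : ∃ l < 64, point l = v :=
    ⟨_, pointIndex_lt v, point_pointIndex v⟩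
  have hzero : point 0 = 0 := by decide
  have hk0 : k ≠ 0 := by
    rintro rfl
    exact h (by rw [hzero, wedge_zero_left])
  have hl0 : l ≠ 0 := by
    rintro rfl
    exact h (by rw [hzero, wedge_comm, wedge_zero_left])
  have hkl : k ≠ l := by
    rintro rfl
    exact h (wedge_self _)
  obtain ⟨m, hm⟩ : ∃ m, m = k ^^^ l := ⟨_, rfl⟩
  have hkm : k ^^^ m = l := by rw [hm, ← Nat.xor_assoc, Nat.xor_self, Nat.zero_xor]
  have hlm : l ^^^ m = k := by rw [hm, Nat.xor_comm k, ← Nat.xor_assoc, Nat.xor_self, Nat.zero_xor]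
  have hm64 : m < 64 := hm ▸ Nat.xor_lt_two_pow (n := 6) hk hl
  have hm0 : m ≠ 0 := by
    rintro rfl
    exact hkl (by simpa using hkm)
  have hmk : m ≠ k := by
    rintro rfl
    exact hl0 (by simpa using hkm.symm)
  have hml : m ≠ l := by
    rintro rfl
    exact hk0 (by simpa using hlm.symm)
  have hwkm : wedge (point k) (point m) = wedge (point k) (point l) := by
    rw [hm, point_xor, wedge_add_right, wedge_self, zero_add]
  have hwlm : wedge (point l) (point m) = wedge (point k) (point l) := by
    rw [hm, point_xor, wedge_add_right, wedge_self, add_zero, wedge_comm]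
  have hwlk := wedge_comm (point l) (point k)
  have hwmk := (wedge_comm (point m) (point k)).trans hwkm
  have hwml := (wedge_comm (point m) (point l)).trans hwlm
  rcases lt_or_gt_of_ne hkl with h1 | h1 <;> rcases lt_or_gt_of_ne hmk with h2 | h2 <;>
    rcases lt_or_gt_of_ne hml with h3 | h3
  · exact ⟨m, k, hm64, hk, by omega, h2, by rw [Nat.xor_comm, hkm]; omega, hwmk⟩
  · omega
  · exact ⟨k, m, hk, hm64, by omega, h2, by rw [hkm]; omega, hwkm⟩
  · exact ⟨k, l, hk, hl, by omega, h1, by rw [← hm]; omega, rfl⟩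
  · exact ⟨m, l, hm64, hl, by omega, h3, by rw [Nat.xor_comm, hlm]; omega, hwml⟩
  · exact ⟨l, m, hl, hm64, by omega, h3, by rw [hlm]; omega, hwlm⟩
  · omega
  · exact ⟨l, k, hl, hk, by omega, h1, by rw [Nat.xor_comm, ← hm]; omega, hwlk⟩

theorem homQuad_of_mem_wedgeTables {t : ℕ} (ht : t ∈ wedgeTables) : HomQuad (ofTable t) := by
  obtain ⟨p, -, rfl⟩ := List.mem_map.1 ht
  rw [ofTable_wedgeTable]
  exact homQuad_wedge _ _

end Table
section Walsh

theorem linDist_cons {n : ℕ} (f : BF (n + 1)) (b : ZMod 2) (a : Fin n → ZMod 2) :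
    linDist f (Fin.cons b a) =
      linDist (fun x => f (Fin.cons 0 x)) a + hd (fun x => f (Fin.cons 1 x)) fun x => b + a ⬝ᵥ x := by
  have hsplit : ∀ w : (Fin (n + 1) → ZMod 2) → ℕ,
      ∑ x, w x = ∑ x, w (Fin.cons 0 x) + ∑ x, w (Fin.cons 1 x) := by
    intro w
    rw [← Equiv.sum_comp (Fin.consEquiv fun _ : Fin (n + 1) => ZMod 2) w, Fintype.sum_prod_type]
    exact Fin.sum_univ_two fun c : ZMod 2 => ∑ x : Fin n → ZMod 2, w (Fin.cons c x)
  simp only [linDist, hd, Finset.card_filter]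
  rw [hsplit]
  simp only [dotProduct, Fin.sum_univ_succ, Fin.cons_zero, Fin.cons_succ, mul_zero, mul_one,
    zero_add]
  congr!

/-- All points of `F_2^n`, with the first coordinate varying slowest. -/
def points : (n : ℕ) → List (Fin n → ZMod 2)
  | 0 => [![]]
  | n + 1 => (points n).map (Fin.cons 0) ++ (points n).map (Fin.cons 1)

theorem mem_points : ∀ {n : ℕ} (x : Fin n → ZMod 2), x ∈ points n
  | 0, x => by simp [points, Subsingleton.elim x ![]]
  | n + 1, x => by
    rw [points, List.mem_append, List.mem_map, List.mem_map]
    rcases zmod_two_cases (x 0) with h | h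
    · exact Or.inl ⟨Fin.tail x, mem_points _, by rw [← h, Fin.cons_self_tail]⟩
    · exact Or.inr ⟨Fin.tail x, mem_points _, by rw [← h, Fin.cons_self_tail]⟩

theorem length_points (n : ℕ) : (points n).length = 2 ^ n := by
  induction n with
  | zero => rfl
  | succ n ih => rw [points, List.length_append, List.length_map, List.length_map, ih, pow_succ,
      mul_two]

theorem ofDigits_map_add {α : Type*} (B : ℕ) (l : List α) (p q : α → ℕ) :
    Nat.ofDigits B (l.map fun x => p x + q x) =
      Nat.ofDigits B (l.map p) + Nat.ofDigits B (l.map q) := by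
  induction l with
  | nil => rfl
  | cons x l ih =>
    simp only [List.map_cons, Nat.ofDigits_cons, ih]
    ring

/-- The number with `2 ^ n` digits `1` in base `256`. -/
def repunit : ℕ → ℕ
  | 0 => 1
  | n + 1 => repunit n + 256 ^ 2 ^ n * repunit n

theorem ofDigits_map_const (c n : ℕ) :
    Nat.ofDigits 256 ((points n).map fun _ => c) = repunit n * c := by
  induction n with
  | zero => simp [points, repunit]
  | succ n ih =>
    rw [points, List.map_append, Nat.ofDigits_append, List.map_map, List.map_map]
    simp only [Function.comp_def, List.length_map, length_points]
    rw [ih, repunit]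
    ring

/-- The distances from the function with truth table `t` to all linear forms, as digits in base
`256`. The recursion is restricted to the `2 ^ n` values of the table starting at position `i`.
The recursor and the functions `Nat.add` etc. are used directly to speed up kernel evaluation. -/
def packedDists (t n : ℕ) : ℕ → ℕ :=
  Nat.rec (fun i => Nat.mod (Nat.div t (Nat.pow 2 i)) 2)
    (fun n ih i =>
      Nat.add (Nat.add (ih i) (ih (Nat.add i (Nat.pow 2 n))))
        (Nat.mul (Nat.pow 256 (Nat.pow 2 n))
          (Nat.sub (Nat.add (ih i) (Nat.mul (repunit n) (Nat.pow 2 n)))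
            (ih (Nat.add i (Nat.pow 2 n)))))) n

theorem packedDists_succ (t n i : ℕ) :
    packedDists t (n + 1) i =
      packedDists t n i + packedDists t n (i + 2 ^ n) + 256 ^ 2 ^ n *
        (packedDists t n i + repunit n * 2 ^ n - packedDists t n (i + 2 ^ n)) :=
  rfl

theorem packedDists_eq (t n i : ℕ) :
    packedDists t n i = Nat.ofDigits 256
      ((points n).map (linDist fun x => bit t (i + pointIndex n x))) := by
  induction n generalizing i with
  | zero =>
    have hbit : linDist (fun x : Fin 0 → ZMod 2 => bit t (i + pointIndex 0 x)) ![] =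
        t / 2 ^ i % 2 := by
      rcases Nat.mod_two_eq_zero_or_one (t / 2 ^ i) with h | h <;>
        simp [linDist, hd, bit, pointIndex, h]
    rw [points, List.map_singleton, Nat.ofDigits_singleton, hbit]
    rfl
  | succ n ih =>
    set f₀ : BF n := fun x => bit t (i + pointIndex n x) with hf₀
    set f₁ : BF n := fun x => bit t (i + 2 ^ n + pointIndex n x) with hf₁
    have h₀ : (fun x : Fin n → ZMod 2 => bit t (i + pointIndex (n + 1) (Fin.cons 0 x))) = f₀ := by
      simp [pointIndex, hf₀]
    have h₁ : (fun x : Fin n → ZMod 2 => bit t (i + pointIndex (n + 1) (Fin.cons 1 x))) = f₁ := by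
      simp [pointIndex, hf₁, ZMod.val_one, add_assoc]
    have hzero : ∀ a, linDist (fun x => bit t (i + pointIndex (n + 1) x)) (Fin.cons 0 a) =
        linDist f₀ a + linDist f₁ a := by
      intro a
      rw [linDist_cons, h₀, h₁]
      simp [linDist]
    have hone : ∀ a, linDist (fun x => bit t (i + pointIndex (n + 1) x)) (Fin.cons 1 a) =
        linDist f₀ a + (2 ^ n - linDist f₁ a) := by
      intro a
      rw [linDist_cons, h₀, h₁, hd_one_add]
      rfl
    have hcompl : Nat.ofDigits 256 ((points n).map fun a => 2 ^ n - linDist f₁ a) +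
        Nat.ofDigits 256 ((points n).map (linDist f₁)) = repunit n * 2 ^ n := by
      rw [← ofDigits_map_add, ← ofDigits_map_const]
      congr 2
      funext a
      exact Nat.sub_add_cancel (hd_le _ _)
    rw [packedDists_succ, ih, ih, points, List.map_append, Nat.ofDigits_append, List.map_map,
      List.map_map]
    simp only [Function.comp_def, List.length_map, length_points, hzero, hone]
    rw [ofDigits_map_add, ofDigits_map_add, ← hcompl, ← add_assoc, Nat.add_sub_cancel]

/-- Whether the first `n` digits of `X` in base `256` all satisfy `p`. -/
def allDigits (p : ℕ → Bool) : ℕ → ℕ → Bool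
  | 0, _ => true
  | n + 1, X => p (Nat.mod X 256) && allDigits p n (Nat.div X 256)

theorem allDigits_succ (p : ℕ → Bool) (n X : ℕ) :
    allDigits p (n + 1) X = (p (X % 256) && allDigits p n (X / 256)) :=
  rfl

theorem allDigits_ofDigits (p : ℕ → Bool) {l : List ℕ} (h : ∀ d ∈ l, d < 256) :
    allDigits p l.length (Nat.ofDigits 256 l) = l.all p := by
  induction l with
  | nil => rfl
  | cons d l ih =>
    have hd : d < 256 := h d (by simp)
    rw [List.length_cons, allDigits_succ, Nat.ofDigits_cons, List.all_cons,
      Nat.add_mul_mod_self_left, Nat.add_mul_div_left _ _ (by norm_num),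
      Nat.mod_eq_of_lt hd, Nat.div_eq_of_lt hd, zero_add,
      ih fun e he => h e (List.mem_cons_of_mem d he)]

theorem allDigits_packedDists (p : ℕ → Bool) (t : ℕ) :
    allDigits p 64 (packedDists t 6 0) = true ↔ ∀ a, p (linDist (ofTable t) a) = true := by
  have hlen : ((points 6).map (linDist (ofTable t))).length = 64 := by
    rw [List.length_map, length_points]; rfl
  have hpack : packedDists t 6 0 = Nat.ofDigits 256 ((points 6).map (linDist (ofTable t))) := by
    rw [packedDists_eq]
    simp only [zero_add]
    rfl
  rw [hpack, ← hlen, allDigits_ofDigits, List.all_map, List.all_eq_true]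
  · exact ⟨fun h a => h a (mem_points a), fun h a _ => h a⟩
  · intro d hd
    obtain ⟨a, -, rfl⟩ := List.mem_map.1 hd
    exact (hd_le _ _).trans_lt (by norm_num)

/-- Whether the function with truth table `t` has nonlinearity `16`. -/
def hasNlSixteen (t : ℕ) : Bool :=
  allDigits (fun d => Nat.ble 16 d && Nat.ble d 48) 64 (packedDists t 6 0) &&
    !allDigits (fun d => !(Nat.beq d 16 || Nat.beq d 48)) 64 (packedDists t 6 0)

theorem hasNlSixteen_iff (t : ℕ) : hasNlSixteen t = true ↔ nl 1 (ofTable t) = 16 := by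
  rw [nl_one_eq_sixteen_iff, hasNlSixteen, Bool.and_eq_true, allDigits_packedDists,
    Bool.not_eq_true', ← Bool.not_eq_true, allDigits_packedDists, not_forall]
  have hor : ∀ d : ℕ, (!(Nat.beq d 16 || Nat.beq d 48)) ≠ true ↔ d = 16 ∨ d = 48 := by
    intro d
    rw [ne_eq, Bool.not_eq_true, Bool.not_eq_false', Bool.or_eq_true, Nat.beq_eq, Nat.beq_eq]
  simp only [hor, Bool.and_eq_true, Nat.ble_eq]

end Walsh

/-- The truth tables of the functions in `Fh (ofTable t) 16 ∩ S16`. -/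
def solutionTables (t : ℕ) : List ℕ :=
  wedgeTables.filter fun s => hasNlSixteen (t ^^^ s) && hasNlSixteen s

theorem Fh_inter_S16_eq (t : ℕ) :
    Fh (ofTable t) 16 ∩ S16 = ofTable '' ((solutionTables t).toFinset : Set ℕ) := by
  have hmem : ∀ s, s ∈ ((solutionTables t).toFinset : Set ℕ) ↔ s ∈ wedgeTables ∧
      nl 1 (ofTable t + ofTable s) = 16 ∧ nl 1 (ofTable s) = 16 := by
    intro s
    rw [SetLike.mem_coe, List.mem_toFinset, solutionTables, List.mem_filter, Bool.and_eq_true,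
      hasNlSixteen_iff, hasNlSixteen_iff, ofTable_xor]
  ext g
  constructor
  · rintro ⟨⟨hquad, hadd⟩, hnl⟩
    obtain ⟨u, v, rfl⟩ := exists_eq_wedge_of_nl_eq_sixteen hquad hnl
    have hne : wedge u v ≠ 0 := by
      intro h
      have hle := ((nl_one_eq_iff _ _).1 hnl).1 0 0
      rw [h] at hle
      simp [hd] at hle
    obtain ⟨s, hs, hsuv⟩ := exists_mem_wedgeTables hne
    rw [← hsuv] at hadd hnl ⊢
    exact ⟨s, (hmem s).2 ⟨hs, hadd, hnl⟩, rfl⟩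
  · rintro ⟨s, hs, rfl⟩
    obtain ⟨hw, hadd, hnl⟩ := (hmem s).1 hs
    exact ⟨⟨homQuad_of_mem_wedgeTables hw, hadd⟩, hnl⟩

theorem wedgeTables_lt : ∀ s ∈ wedgeTables, s < 2 ^ 64 := by
  decide +kernel

theorem ncard_Fh_inter_S16 (t : ℕ) :
    (Fh (ofTable t) 16 ∩ S16).ncard = (solutionTables t).toFinset.card := by
  rw [Fh_inter_S16_eq, Set.InjOn.ncard_image, Set.ncard_coe_finset]
  refine ofTable_injOn.mono fun s hs => wedgeTables_lt s ?_
  exact (List.mem_filter.1 (List.mem_toFinset.1 hs)).1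

theorem fun2_eq_ofTable : fun2 = ofTable 6227001369081937920 := by
  funext x; revert x; decide +kernel

theorem fun4_eq_ofTable : fun4 = ofTable 3936335606665183232 := by
  funext x; revert x; decide +kernel

/-- `|Fh_{fun2}(16) ∩ S16| = 47` and `|Fh_{fun4}(16) ∩ S16| = 43`. -/
theorem stmt8 :
    (Fh fun2 16 ∩ S16).ncard = 47 ∧ (Fh fun4 16 ∩ S16).ncard = 43 := by
  rw [fun2_eq_ofTable, fun4_eq_ofTable, ncard_Fh_inter_S16, ncard_Fh_inter_S16]
  constructor <;> decide +kernel
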